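/- arXiv:1706.03958 — 2 statements merged into one kernel-verified Lean document; each statement's English description precedes it below -/
import Mathlib

section
/- Fix n ≥ d, nonnegative reals σ₁, …, σ_d, c ∈ ℝ^n, regularizers ν, μ > 0, and γ > 0. Let α^t be the gradient descent iterates on the diagonalized dual ridge objective Q_μ with step size nμγ (i.e., α^{t+1} = α^t − nμγ ∇Q_μ(α^t)) initialized at α⁰ = α^{*ν}, the minimizer of Q_ν. Then for every t ≥ 0: (a) α^t_j = α^{*μ}_j for every kernel coordinate j > d (these coordinates remain exactly optimal); and (b) the suboptimality satisfies the exact identity Q_μ(α^t) − Q_μ(α^{*μ}) = (1/2) Σ_{i=1}^d ((σ_i² + μ)/(nμ)) (1 − γ(σ_i² + μ))^{2t} (α^{*ν}_i − α^{*μ}_i)². -/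
open Finset

/-- The suboptimality of a point for a separable quadratic with critical point `y`. -/
theorem separable_quadratic_sub_eq {ι : Type*} [Fintype ι] (a c x y : ι → ℝ)
    (hy : ∀ i, a i * y i = c i) :
    ((1 / 2) * ∑ i, a i * x i ^ 2 - ∑ i, c i * x i) -
        ((1 / 2) * ∑ i, a i * y i ^ 2 - ∑ i, c i * y i) =
      (1 / 2) * ∑ i, a i * (x i - y i) ^ 2 := by
  simp only [mul_sum, ← sum_sub_distrib]
  refine sum_congr rfl fun i _ => ?_
  rw [← hy i]
  ring

/-- The error of gradient descent with step size `s` on a scalar quadratic with curvature `a`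
and critical point `y` contracts geometrically with ratio `1 - s * a`. -/
theorem scalar_gd_error_eq (a c s y : ℝ) (hy : a * y = c) (x : ℕ → ℝ)
    (hx : ∀ t, x (t + 1) = x t - s * (a * x t - c)) (t : ℕ) :
    x t - y = (1 - s * a) ^ t * (x 0 - y) := by
  induction t with
  | zero => simp
  | succ t ih =>
    rw [pow_succ', mul_assoc, ← ih, hx, ← hy]
    ring

/-- Gradient descent on the diagonalized dual ridge objective `Q_μ` with step
size `nμγ`, initialized at the minimizer `α^{*ν}` of `Q_ν` (homotopic initialization),
keeps all kernel coordinates `j ≥ d` exactly optimal, and satisfies the exact suboptimality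
identity
`Q_μ(α^t) − Q_μ(α^{*μ}) = (1/2) Σ_{i<d} ((σ_i²+μ)/(nμ)) (1 − γ(σ_i²+μ))^{2t} (α^{*ν}_i − α^{*μ}_i)²`. -/
theorem homotopic_gd_dual {n d : ℕ} (hn : 0 < n) (hd : d ≤ n)
    (σ : ℕ → ℝ) (hσ : ∀ i, 0 ≤ σ i) (c : Fin n → ℝ)
    (Γ : ℝ → Fin n → ℝ)
    (hΓ : ∀ μ (i : Fin n),
      Γ μ i = if (i : ℕ) < d then (σ (i : ℕ) ^ 2 + μ) / (n * μ) else 1 / n)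
    (Q : ℝ → (Fin n → ℝ) → ℝ)
    (hQ : ∀ μ α, Q μ α = (1 / 2) * ∑ i, Γ μ i * α i ^ 2 - ∑ i, c i * α i)
    (αstar : ℝ → Fin n → ℝ)
    (hαstar : ∀ μ (i : Fin n),
      αstar μ i = if (i : ℕ) < d then n * μ * c i / (σ (i : ℕ) ^ 2 + μ) else n * c i)
    (μ ν γ : ℝ) (hμ : 0 < μ) (hν : 0 < ν) (hγ : 0 < γ)
    (α : ℕ → Fin n → ℝ) (hα0 : α 0 = αstar ν)
    (hupd : ∀ t (i : Fin n),
      α (t + 1) i = α t i - (n * μ * γ) * (Γ μ i * α t i - c i)) :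
    (∀ t, ∀ j : Fin n, d ≤ (j : ℕ) → α t j = αstar μ j) ∧
      ∀ t, Q μ (α t) - Q μ (αstar μ) =
        (1 / 2) * ∑ i ∈ univ.filter (fun i : Fin n => (i : ℕ) < d),
          ((σ (i : ℕ) ^ 2 + μ) / (n * μ)) * (1 - γ * (σ (i : ℕ) ^ 2 + μ)) ^ (2 * t) *
            (αstar ν i - αstar μ i) ^ 2 := by
  have hn' : (n : ℝ) ≠ 0 := Nat.cast_ne_zero.mpr hn.ne'
  have hcrit : ∀ i, Γ μ i * αstar μ i = c i := fun i => by
    have hi : σ (i : ℕ) ^ 2 + μ ≠ 0 := by positivity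
    rw [hΓ, hαstar]
    split_ifs <;> field_simp
  have herr : ∀ t i, α t i - αstar μ i =
      (1 - n * μ * γ * Γ μ i) ^ t * (αstar ν i - αstar μ i) := fun t i => by
    rw [← hα0]
    exact scalar_gd_error_eq _ _ _ _ (hcrit i) (fun t => α t i) (fun t => hupd t i) t
  have hker : ∀ t, ∀ j : Fin n, d ≤ (j : ℕ) → α t j = αstar μ j := fun t j hj => by
    rw [← sub_eq_zero, herr, hαstar ν, hαstar μ, if_neg hj.not_gt, if_neg hj.not_gt, sub_self,
      mul_zero]
  refine ⟨hker, fun t => ?_⟩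
  rw [hQ, hQ, separable_quadratic_sub_eq _ _ _ _ hcrit, sum_filter]
  congr 1
  refine sum_congr rfl fun i _ => ?_
  split_ifs with hi
  · have hstep : n * μ * γ * Γ μ i = γ * (σ (i : ℕ) ^ 2 + μ) := by
      rw [hΓ, if_pos hi]
      field_simp
    rw [herr, hstep, hΓ, if_pos hi]
    ring
  · rw [hker t i (not_lt.mp hi)]
    ring
end

section
/- Let G be a symmetric positive definite n×n real matrix, Q(α) = (1/2) αᵀGα − bᵀα with minimizer α* = G⁻¹b, and use coordinate-wise step sizes γ_r = (G_{rr} + Σ_j |G_{rj}|)⁻¹ with γ_min = min_r γ_r and γ_max = max_r γ_r. Let α^{(t)} be the random iterate after t steps of random coordinate descent from α⁰, where at each step a coordinate r is drawn uniformly and independently and α ← α − γ_r (∇Q(α))_r e_r; expectations are averages over all n^t coordinate sequences. Then E‖α^{(t)} − α*‖² ≤ (γ_max/γ_min) ‖α⁰ − α*‖² for every t ≥ 0. -/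
open Matrix

/-- One step of coordinate descent at coordinate `r`:
`α ← α − γ_r (∇Q(α))_r e_r` for the quadratic `Q(α) = (1/2)αᵀGα − bᵀα`. -/
noncomputable def rcdStep {n : ℕ} (G : Matrix (Fin n) (Fin n) ℝ) (b : Fin n → ℝ)
    (γ : Fin n → ℝ) (α : Fin n → ℝ) (r : Fin n) : Fin n → ℝ :=
  Function.update α r (α r - γ r * (G.mulVec α - b) r)

/-- The iterate after `t` coordinate descent steps along the coordinate sequence `ω`. -/
noncomputable def rcdIter {n : ℕ} (G : Matrix (Fin n) (Fin n) ℝ) (b : Fin n → ℝ)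
    (γ : Fin n → ℝ) (α0 : Fin n → ℝ) {t : ℕ} (ω : Fin t → Fin n) : Fin n → ℝ :=
  (List.ofFn ω).foldl (rcdStep G b γ) α0

/-- Expectation of `f` at the `t`-th iterate of random coordinate descent (coordinates
drawn uniformly and independently): the average over all `n^t` coordinate sequences. -/
noncomputable def rcdExp {n : ℕ} (G : Matrix (Fin n) (Fin n) ℝ) (b : Fin n → ℝ)
    (γ : Fin n → ℝ) (α0 : Fin n → ℝ) (t : ℕ) (f : (Fin n → ℝ) → ℝ) : ℝ :=
  (1 / (n : ℝ) ^ t) * ∑ ω : Fin t → Fin n, f (rcdIter G b γ α0 ω)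

/-- The iterate along `r :: ω` is the iterate along `ω` started after the step at `r`. -/
lemma rcdIter_cons {n : ℕ} (G : Matrix (Fin n) (Fin n) ℝ) (b γ α0 : Fin n → ℝ) {t : ℕ}
    (r : Fin n) (ω : Fin t → Fin n) :
    rcdIter G b γ α0 (Fin.cons r ω : Fin (t + 1) → Fin n) =
      rcdIter G b γ (rcdStep G b γ α0 r) ω := by
  simp [rcdIter, List.ofFn_succ]

/-- A function whose average over one step does not increase has nonincreasing expectation
along random coordinate descent. -/
lemma sum_rcdIter_le {n : ℕ} (G : Matrix (Fin n) (Fin n) ℝ) (b γ : Fin n → ℝ)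
    (V : (Fin n → ℝ) → ℝ) (hV : ∀ α, ∑ r, V (rcdStep G b γ α r) ≤ n * V α) (t : ℕ)
    (α0 : Fin n → ℝ) :
    ∑ ω : Fin t → Fin n, V (rcdIter G b γ α0 ω) ≤ (n : ℝ) ^ t * V α0 := by
  induction t generalizing α0 with
  | zero => simp [rcdIter]
  | succ t ih =>
    rw [← (Fin.consEquiv fun _ : Fin (t + 1) => Fin n).sum_comp, Fintype.sum_prod_type]
    calc ∑ r, ∑ ω : Fin t → Fin n, V (rcdIter G b γ α0 (Fin.cons r ω : Fin (t + 1) → Fin n))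
        ≤ ∑ r, (n : ℝ) ^ t * V (rcdStep G b γ α0 r) :=
          Finset.sum_le_sum fun r _ => by simpa only [rcdIter_cons] using ih _
      _ ≤ (n : ℝ) ^ t * (n * V α0) := by
          rw [← Finset.mul_sum]
          exact mul_le_mul_of_nonneg_left (hV α0) (by positivity)
      _ = (n : ℝ) ^ (t + 1) * V α0 := by ring

/-- A symmetric matrix is dominated by the diagonal matrix of its absolute row sums. -/
lemma dotProduct_mulVec_le_sum_abs {ι : Type*} [Fintype ι] (G : Matrix ι ι ℝ) (hG : G.IsSymm)
    (u : ι → ℝ) : u ⬝ᵥ G *ᵥ u ≤ ∑ i, (∑ j, |G i j|) * u i ^ 2 := by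
  have hsymm : ∑ i, ∑ j, |G i j| * u j ^ 2 = ∑ i, ∑ j, |G i j| * u i ^ 2 := by
    rw [Finset.sum_comm]
    simp only [hG.apply]
  have hterm (i j : ι) : u i * (G i j * u j) ≤ (|G i j| * u i ^ 2 + |G i j| * u j ^ 2) / 2 := by
    have h := le_abs_self (G i j)
    have h' := neg_abs_le (G i j)
    nlinarith [mul_nonneg (sub_nonneg.2 h) (sq_nonneg (u i - u j)),
      mul_nonneg (neg_le_iff_add_nonneg.1 h') (sq_nonneg (u i + u j)),
      mul_nonneg (sub_nonneg.2 h) (sq_nonneg (u i + u j)),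
      mul_nonneg (neg_le_iff_add_nonneg.1 h') (sq_nonneg (u i - u j))]
  calc u ⬝ᵥ G *ᵥ u = ∑ i, ∑ j, u i * (G i j * u j) := by
        simp only [dotProduct, mulVec, Finset.mul_sum]
    _ ≤ ∑ i, ∑ j, (|G i j| * u i ^ 2 + |G i j| * u j ^ 2) / 2 :=
        Finset.sum_le_sum fun i _ => Finset.sum_le_sum fun j _ => hterm i j
    _ = ∑ i, (∑ j, |G i j|) * u i ^ 2 := by
        simp only [← Finset.sum_div, Finset.sum_add_distrib, hsymm, Finset.sum_mul]
        ring

/-- If `G` is positive semidefinite and dominated by the diagonal matrix of the inverse step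
sizes `γ`, then `G diag(γ) G` is dominated by `G`. -/
lemma sum_mul_mulVec_sq_le {ι : Type*} [Fintype ι] {G : Matrix ι ι ℝ} (hG : G.PosSemidef)
    {γ : ι → ℝ} (hγ : ∀ i, 0 < γ i) (hdom : ∀ u, u ⬝ᵥ G *ᵥ u ≤ ∑ i, (γ i)⁻¹ * u i ^ 2)
    (e : ι → ℝ) : ∑ i, γ i * (G *ᵥ e) i ^ 2 ≤ e ⬝ᵥ G *ᵥ e := by
  set u : ι → ℝ := fun i => γ i * (G *ᵥ e) i with hu
  have hug : u ⬝ᵥ G *ᵥ e = ∑ i, γ i * (G *ᵥ e) i ^ 2 :=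
    Finset.sum_congr rfl fun i _ => by simp only [hu]; ring
  have hGT : Gᵀ = G := by simpa using hG.isHermitian.eq
  have heu : e ⬝ᵥ G *ᵥ u = u ⬝ᵥ G *ᵥ e := by
    rw [dotProduct_mulVec, ← mulVec_transpose, hGT, dotProduct_comm]
  have hpos : 0 ≤ (e - u) ⬝ᵥ G *ᵥ (e - u) := by
    simpa using hG.dotProduct_mulVec_nonneg (e - u)
  have huu : u ⬝ᵥ G *ᵥ u ≤ ∑ i, γ i * (G *ᵥ e) i ^ 2 :=
    (hdom u).trans_eq <| Finset.sum_congr rfl fun i _ => by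
      have := (hγ i).ne'
      simp only [hu]
      field_simp
  simp only [mulVec_sub, dotProduct_sub, sub_dotProduct] at hpos
  linarith

/-- The change of a weighted squared distance when one coordinate is updated. -/
lemma sum_mul_update_sub_sq {ι : Type*} [Fintype ι] [DecidableEq ι] (w α s : ι → ℝ) (r : ι)
    (v : ℝ) : ∑ i, w i * (Function.update α r v i - s i) ^ 2 =
      ∑ i, w i * (α i - s i) ^ 2 + w r * ((v - s r) ^ 2 - (α r - s r) ^ 2) := by
  rw [← sub_eq_iff_eq_add', ← Finset.sum_sub_distrib, Finset.sum_eq_single r]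
  · simp only [Function.update_self]
    ring
  · intro i _ hi
    simp [Function.update_of_ne hi]
  · simp

/-- The squared distance to a critical point, weighted by the inverse step sizes, does not
increase on average in one step of random coordinate descent. -/
lemma sum_rcdStep_le {n : ℕ} {G : Matrix (Fin n) (Fin n) ℝ} (hG : G.PosSemidef)
    {b γ s : Fin n → ℝ} (hs : G *ᵥ s = b) (hγ : ∀ i, 0 < γ i)
    (hdom : ∀ u, u ⬝ᵥ G *ᵥ u ≤ ∑ i, (γ i)⁻¹ * u i ^ 2) (α : Fin n → ℝ) :
    ∑ r, ∑ i, (γ i)⁻¹ * (rcdStep G b γ α r i - s i) ^ 2 ≤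
      n * ∑ i, (γ i)⁻¹ * (α i - s i) ^ 2 := by
  have hg : G *ᵥ α - b = G *ᵥ (α - s) := by rw [mulVec_sub, hs]
  have hterm (r : Fin n) : (γ r)⁻¹ *
      ((α r - γ r * (G *ᵥ (α - s)) r - s r) ^ 2 - (α r - s r) ^ 2) =
      γ r * (G *ᵥ (α - s)) r ^ 2 - 2 * ((α - s) r * (G *ᵥ (α - s)) r) := by
    have := (hγ r).ne'
    simp only [Pi.sub_apply]
    field_simp
    ring
  have hle := sum_mul_mulVec_sq_le hG hγ hdom (α - s)
  have hpos : 0 ≤ (α - s) ⬝ᵥ G *ᵥ (α - s) := by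
    simpa using hG.dotProduct_mulVec_nonneg (α - s)
  simp only [rcdStep, sum_mul_update_sub_sq, hg, hterm]
  rw [Finset.sum_add_distrib, Finset.sum_sub_distrib, ← Finset.mul_sum]
  simp only [Finset.sum_const, Finset.card_univ, Fintype.card_fin, nsmul_eq_mul]
  change _ + (_ - 2 * ((α - s) ⬝ᵥ G *ᵥ (α - s))) ≤ _
  linarith

/-- For a symmetric positive definite quadratic `Q(α) = (1/2)αᵀGα − bᵀα`
with minimizer `α* = G⁻¹b` and coordinate-wise step sizes `γ_r = (G_{rr} + Σ_j |G_{rj}|)⁻¹`,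
random coordinate descent satisfies `E‖α^{(t)} − α*‖² ≤ (γ_max/γ_min)‖α⁰ − α*‖²` for all
`t ≥ 0`. -/
theorem rcdm_distance_bound {n : ℕ} [NeZero n]
    (G : Matrix (Fin n) (Fin n) ℝ) (hG : G.PosDef)
    (b : Fin n → ℝ)
    (Q : (Fin n → ℝ) → ℝ)
    (hQ : ∀ α, Q α = (1 / 2) * (α ⬝ᵥ G.mulVec α) - b ⬝ᵥ α)
    (αstar : Fin n → ℝ) (hαstar : αstar = G⁻¹.mulVec b)
    (γ : Fin n → ℝ) (hγ : ∀ r, γ r = (G r r + ∑ j, |G r j|)⁻¹)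
    (γmin γmax : ℝ)
    (hγmin : γmin = Finset.univ.inf' Finset.univ_nonempty γ)
    (hγmax : γmax = Finset.univ.sup' Finset.univ_nonempty γ)
    (α0 : Fin n → ℝ) :
    ∀ t : ℕ, rcdExp G b γ α0 t (fun α => ∑ i, (α i - αstar i) ^ 2) ≤
      (γmax / γmin) * ∑ i, (α0 i - αstar i) ^ 2 := by
  have hDpos (r : Fin n) : 0 < G r r + ∑ j, |G r j| :=
    add_pos_of_pos_of_nonneg hG.diag_pos (Finset.sum_nonneg fun j _ => abs_nonneg _)
  have hpos (r : Fin n) : 0 < γ r := by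
    rw [hγ]
    exact inv_pos.2 (hDpos r)
  have hmin (r : Fin n) : γmin ≤ γ r := hγmin ▸ Finset.inf'_le _ (Finset.mem_univ r)
  have hmax (r : Fin n) : γ r ≤ γmax := hγmax ▸ Finset.le_sup' _ (Finset.mem_univ r)
  have hminpos : 0 < γmin := by
    rw [hγmin, Finset.lt_inf'_iff]
    exact fun r _ => hpos r
  have hmaxpos : 0 < γmax := (hpos 0).trans_le (hmax 0)
  have hs : G *ᵥ αstar = b := by
    rw [hαstar, mulVec_mulVec, mul_nonsing_inv G hG.det_pos.ne'.isUnit, one_mulVec]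
  have hdom (u : Fin n → ℝ) : u ⬝ᵥ G *ᵥ u ≤ ∑ i, (γ i)⁻¹ * u i ^ 2 := by
    refine (dotProduct_mulVec_le_sum_abs G (by simpa [IsSymm] using hG.isHermitian.eq) u).trans ?_
    gcongr with i
    rw [hγ, inv_inv]
    exact le_add_of_nonneg_left hG.diag_pos.le
  have hupper (x : Fin n → ℝ) :
      ∑ i, (x i - αstar i) ^ 2 ≤ γmax * ∑ i, (γ i)⁻¹ * (x i - αstar i) ^ 2 := by
    rw [Finset.mul_sum]
    gcongr with i
    rw [← mul_assoc, ← div_eq_mul_inv]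
    exact le_mul_of_one_le_left (sq_nonneg _) ((one_le_div (hpos i)).2 (hmax i))
  have hlower : ∑ i, (γ i)⁻¹ * (α0 i - αstar i) ^ 2 ≤
      γmin⁻¹ * ∑ i, (α0 i - αstar i) ^ 2 := by
    rw [Finset.mul_sum]
    gcongr with i
    exact hmin i
  intro t
  have hn : (0 : ℝ) < (n : ℝ) ^ t := pow_pos (Nat.cast_pos.2 (NeZero.pos n)) t
  have hsum := sum_rcdIter_le G b γ (fun x => ∑ i, (γ i)⁻¹ * (x i - αstar i) ^ 2)
    (sum_rcdStep_le hG.posSemidef hs hpos hdom) t α0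
  rw [rcdExp, one_div, inv_mul_le_iff₀ hn]
  calc ∑ ω : Fin t → Fin n, ∑ i, (rcdIter G b γ α0 ω i - αstar i) ^ 2
      ≤ γmax * ∑ ω : Fin t → Fin n,
          ∑ i, (γ i)⁻¹ * (rcdIter G b γ α0 ω i - αstar i) ^ 2 := by
        rw [Finset.mul_sum]
        exact Finset.sum_le_sum fun ω _ => hupper _
    _ ≤ γmax * ((n : ℝ) ^ t * (γmin⁻¹ * ∑ i, (α0 i - αstar i) ^ 2)) := by
        refine mul_le_mul_of_nonneg_left (hsum.trans ?_) hmaxpos.le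
        exact mul_le_mul_of_nonneg_left hlower hn.le
    _ = (n : ℝ) ^ t * (γmax / γmin * ∑ i, (α0 i - αstar i) ^ 2) := by ring
end
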